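/- Let P be a non-constant complex polynomial, and let P̄ denote the polynomial obtained from P by conjugating all coefficients. The bivariate polynomial L_P(x, y) = P(x + iy)·P̄(x − iy) − 1 is reducible over ℂ if and only if P = P₁^d for some complex polynomial P₁ and some integer d > 1. -/

import Mathlib

/-- A bivariate polynomial is reducible if it is a product of two non-constant
polynomials. -/
def MvPolynomial.IsReducibleOverC (F : MvPolynomial (Fin 2) ℂ) : Prop :=
  ∃ G H : MvPolynomial (Fin 2) ℂ, 0 < G.totalDegree ∧ 0 < H.totalDegree ∧ F = G * H

/-- `L_P(x, y) = P(x + iy)·P̄(x − iy) − 1` as a polynomial in `ℂ[x, y]`. -/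
noncomputable def Polynomial.LP (P : Polynomial ℂ) : MvPolynomial (Fin 2) ℂ :=
  Polynomial.aeval
      ((MvPolynomial.X 0 : MvPolynomial (Fin 2) ℂ) +
        MvPolynomial.C Complex.I * MvPolynomial.X 1) P *
    Polynomial.aeval
      ((MvPolynomial.X 0 : MvPolynomial (Fin 2) ℂ) -
        MvPolynomial.C Complex.I * MvPolynomial.X 1) (P.map (starRingEnd ℂ)) - 1

open Polynomial in
/-- A complex polynomial whose root multiplicities are all divisible by `d ≠ 0` is a `d`-th
power. -/
theorem Polynomial.exists_eq_pow_of_dvd_count_roots (P : ℂ[X]) {d : ℕ} (hd : d ≠ 0)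
    (h : ∀ a, d ∣ P.roots.count a) : ∃ R : ℂ[X], P = R ^ d := by
  obtain ⟨c, hc⟩ := IsAlgClosed.exists_pow_nat_eq P.leadingCoeff (Nat.pos_of_ne_zero hd)
  obtain ⟨s, hs⟩ : ∃ s : Multiset ℂ, P.roots = d • s := by
    refine ⟨∑ a ∈ P.roots.toFinset, (P.roots.count a / d) • {a}, ?_⟩
    rw [Finset.smul_sum]
    conv_lhs => rw [← Multiset.toFinset_sum_count_nsmul_eq P.roots]
    refine Finset.sum_congr rfl fun a _ ↦ ?_
    rw [← mul_smul, Nat.mul_div_cancel' (h a)]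
  refine ⟨C c * (s.map (X - C ·)).prod, ?_⟩
  conv_lhs => rw [(IsAlgClosed.splits P).eq_prod_roots, hs, ← hc]
  rw [Multiset.map_nsmul, Multiset.prod_nsmul, mul_pow, C_pow]

open Polynomial in
/-- If `P ^ k` and `g ^ n` agree up to a unit and `0 < k < n`, then `P` is a proper power. -/
theorem Polynomial.exists_eq_pow_of_associated_pow {P g : ℂ[X]} {k n : ℕ}
    (hk : 0 < k) (hkn : k < n) (h : Associated (P ^ k) (g ^ n)) :
    ∃ (R : ℂ[X]) (d : ℕ), 1 < d ∧ P = R ^ d := by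
  have hroots : k • P.roots = n • g.roots := by
    rw [← roots_pow, ← roots_pow, h.roots_eq]
  have he : 0 < n.gcd k := Nat.gcd_pos_of_pos_right _ hk
  obtain ⟨d, hd⟩ := Nat.gcd_dvd_left n k
  have hdef : n / n.gcd k = d := Nat.div_eq_of_eq_mul_right he hd
  have hle : n.gcd k ≤ k := Nat.gcd_le_right _ hk
  have h1 : 1 < d := by
    by_contra! hd1
    nlinarith
  obtain ⟨R, hR⟩ := exists_eq_pow_of_dvd_count_roots P (d := d) (by lia) fun a ↦ by
    have hc : k * P.roots.count a = n * g.roots.count a := by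
      simpa using congrArg (Multiset.count a) hroots
    have : d ∣ k / n.gcd k * P.roots.count a := Nat.dvd_of_mul_dvd_mul_left he (by
      rw [← hd, ← mul_assoc, Nat.mul_div_cancel' (Nat.gcd_dvd_right n k), hc]
      exact dvd_mul_right _ _)
    refine Nat.Coprime.dvd_of_dvd_mul_left ?_ this
    rw [← hdef]
    exact Nat.coprime_div_gcd_div_gcd he
  exact ⟨R, d, h1, hR⟩

open Polynomial in
/-- If `P(z) Q(w) - 1` is a product of two non-units of `ℂ[z][w]`, with `Q` non-constant, then
`P` is a proper power. -/
theorem Polynomial.exists_eq_pow_of_mul_sub_one_eq_mul {P Q : ℂ[X]} (hP : P ≠ 0)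
    (hQ : 0 < Q.natDegree) {G H : ℂ[X][X]} (hG : ¬ IsUnit G) (hH : ¬ IsUnit H)
    (hGH : C P * Q.map C - 1 = G * H) :
    ∃ (R : ℂ[X]) (d : ℕ), 1 < d ∧ P = R ^ d := by
  have hinj : Function.Injective (C : ℂ →+* ℂ[X]) := C_injective
  have hnd : (Q.map C).natDegree = Q.natDegree := natDegree_map_eq_of_injective hinj Q
  have hdeg : (C P * Q.map C - 1).natDegree = Q.natDegree := by
    rw [← C_1, natDegree_sub_C, natDegree_C_mul hP, hnd]
  have hne : G * H ≠ 0 := by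
    rw [← hGH]
    intro h
    rw [h] at hdeg
    simp at hdeg
    lia
  have hsum : G.natDegree + H.natDegree = Q.natDegree := by
    rw [← natDegree_mul (left_ne_zero_of_mul hne) (right_ne_zero_of_mul hne), ← hGH, hdeg]
  have heval {b : ℂ[X]} (hb : (Q.map C).eval b = 0) : G.eval b * H.eval b = -1 := by
    rw [← eval_mul, ← hGH]
    simp [hb]
  have hpos {A : ℂ[X][X]} (hA : ¬ IsUnit A)
      (h : ∀ b : ℂ[X], (Q.map C).eval b = 0 → IsUnit (A.eval b)) : 0 < A.natDegree := by
    by_contra! h0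
    obtain ⟨b, hb⟩ := IsAlgClosed.exists_root Q (natDegree_pos_iff_degree_pos.mp hQ).ne'
    obtain ⟨a, rfl⟩ := natDegree_eq_zero.mp (Nat.le_zero.mp h0)
    refine hA (isUnit_C.mpr ?_)
    simpa using h (C b) (by rw [eval_map_apply, hb.eq_zero, C_0])
  have hGu (b : ℂ[X]) (hb : (Q.map C).eval b = 0) : IsUnit (G.eval b) :=
    .of_mul_eq_one (-H.eval b) (by linear_combination -heval hb)
  have hHu (b : ℂ[X]) (hb : (Q.map C).eval b = 0) : IsUnit (H.eval b) :=
    .of_mul_eq_one (-G.eval b) (by linear_combination -heval hb)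
  have hGpos := hpos hG hGu
  have hHpos := hpos hH hHu
  refine exists_eq_pow_of_associated_pow (g := G.leadingCoeff) hGpos
    (n := Q.natDegree) (by lia) ?_
  have hres : IsUnit (resultant (Q.map C) G (Q.map C).natDegree G.natDegree) := by
    rw [resultant_eq_prod_eval _ _ _ le_rfl ((IsAlgClosed.splits Q).map C)]
    refine .mul (.pow _ ?_) ?_
    · rw [leadingCoeff_map_of_injective hinj]
      refine isUnit_C.mpr (IsUnit.mk0 _ ?_)
      intro h
      rw [leadingCoeff_eq_zero.mp h] at hQ
      simp at hQ
    · refine Multiset.prod_induction IsUnit _ (fun _ _ ↦ .mul) isUnit_one ?_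
      simp only [Multiset.mem_map]
      rintro _ ⟨b, hb, rfl⟩
      exact hGu b (isRoot_of_mem_roots hb)
  have key : P ^ G.natDegree * resultant (Q.map C) G (Q.map C).natDegree G.natDegree =
      (-1) ^ (Q.natDegree * G.natDegree) * G.leadingCoeff ^ Q.natDegree := by
    rw [← resultant_C_mul_left, show C P * Q.map C = 1 + G * H by rw [← hGH]; ring,
      resultant_add_mul_left _ _ _ _ _ (by lia) le_rfl, resultant_one_left, hnd]
    rfl
  refine (associated_mul_unit_right _ _ hres).trans ?_
  rw [key]
  exact associated_unit_mul_left _ _ ((isUnit_one.neg).pow _)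

open Polynomial in
/-- The change of variables `x ↦ (z + w) / 2`, `y ↦ (z - w) / (2i)` from `ℂ[x, y]` to `ℂ[z][w]`. -/
noncomputable def MvPolynomial.toConjCoords : MvPolynomial (Fin 2) ℂ →ₐ[ℂ] ℂ[X][X] :=
  MvPolynomial.aeval
    ![Polynomial.C (Polynomial.C (1 / 2)) * (Polynomial.C Polynomial.X + Polynomial.X),
      Polynomial.C (Polynomial.C (-Complex.I / 2)) *
        (Polynomial.C Polynomial.X - Polynomial.X)]

open Polynomial in
theorem MvPolynomial.isUnit_of_isUnit_toConjCoords {G : MvPolynomial (Fin 2) ℂ}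
    (h : IsUnit G.toConjCoords) : IsUnit G := by
  let ψ : ℂ[X][X] →+* MvPolynomial (Fin 2) ℂ :=
    Polynomial.eval₂RingHom
      (Polynomial.aeval (R := ℂ) (X 0 + C Complex.I * X 1 : MvPolynomial (Fin 2) ℂ)).toRingHom
      (X 0 - C Complex.I * X 1)
  have hψ : ψ.comp toConjCoords.toRingHom = RingHom.id _ := by
    have h2 : (C (1 / 2) : MvPolynomial (Fin 2) ℂ) * 2 = 1 := by
      rw [← map_ofNat C 2, ← C_mul]
      norm_num
    have hI : (C (-Complex.I / 2) : MvPolynomial (Fin 2) ℂ) * (2 * C Complex.I) = 1 := by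
      rw [← map_ofNat C 2, ← C_mul, ← C_mul, ← C_1]
      congr 1
      linear_combination -Complex.I_mul_I
    refine MvPolynomial.ringHom_ext (fun r ↦ ?_) fun i ↦ ?_
    · simp [ψ, toConjCoords, Polynomial.algebraMap_apply, MvPolynomial.algebraMap_eq]
    · fin_cases i
      · simp [ψ, toConjCoords, MvPolynomial.algebraMap_eq, -one_div]
        linear_combination X 0 * h2
      · simp [ψ, toConjCoords, MvPolynomial.algebraMap_eq]
        linear_combination X 1 * hI
  have := h.map ψ
  rwa [show ψ G.toConjCoords = G from RingHom.congr_fun hψ G] at this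

open Polynomial in
theorem Polynomial.toConjCoords_LP (P : ℂ[X]) :
    P.LP.toConjCoords = C P * (P.map (starRingEnd ℂ)).map C - 1 := by
  have h2 : (C (C (1 / 2)) : ℂ[X][X]) * 2 = 1 := by
    rw [← map_ofNat C 2, ← map_ofNat C 2, ← C_mul, ← C_mul]
    norm_num
  have hI : (C (C Complex.I) * C (C (-Complex.I / 2)) : ℂ[X][X]) = C (C (1 / 2)) := by
    rw [← C_mul, ← C_mul]
    congr 2
    linear_combination (-1 / 2) * Complex.I_mul_I
  have hC (r : ℂ) : MvPolynomial.toConjCoords (MvPolynomial.C r) = C (C r) :=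
    MvPolynomial.algHom_C _ r
  have h0 : MvPolynomial.toConjCoords (MvPolynomial.X 0) = C (C (1 / 2)) * (C X + X) := by
    simp [MvPolynomial.toConjCoords]
  have h1 : MvPolynomial.toConjCoords (MvPolynomial.X 1) =
      C (C (-Complex.I / 2)) * (C X - X) := by
    simp [MvPolynomial.toConjCoords]
  have hz : MvPolynomial.toConjCoords
      (MvPolynomial.X 0 + MvPolynomial.C Complex.I * MvPolynomial.X 1) = C X := by
    rw [map_add, map_mul, hC, h0, h1]
    linear_combination C X * h2 + (C X - X) * hI
  have hw : MvPolynomial.toConjCoords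
      (MvPolynomial.X 0 - MvPolynomial.C Complex.I * MvPolynomial.X 1) = X := by
    rw [map_sub, map_mul, hC, h0, h1]
    linear_combination X * h2 - (C X - X) * hI
  have haz (Q : ℂ[X]) : aeval (C X : ℂ[X][X]) Q = C Q := by
    simpa using aeval_algebraMap_apply ℂ[X][X] (X : ℂ[X]) Q
  have haw (Q : ℂ[X]) : aeval (X : ℂ[X][X]) Q = Q.map C := by
    exact aeval_X_left_eq_map Q
  rw [LP, map_sub, map_mul, map_one, ← aeval_algHom_apply, ← aeval_algHom_apply, hz, hw, haz, haw]

open Polynomial in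
/-- The product `R(x + iy) R̄(x - iy)` takes every complex value when `R` is non-constant. -/
theorem Polynomial.exists_eval_mul_conj_eq {R : ℂ[X]} (hR : 0 < R.natDegree) (v : ℂ) :
    ∃ f : Fin 2 → ℂ, MvPolynomial.eval f
      (aeval (MvPolynomial.X 0 + MvPolynomial.C Complex.I * MvPolynomial.X 1 :
          MvPolynomial (Fin 2) ℂ) R *
        aeval (MvPolynomial.X 0 - MvPolynomial.C Complex.I * MvPolynomial.X 1 :
          MvPolynomial (Fin 2) ℂ) (R.map (starRingEnd ℂ))) = v := by
  set Q := R.map (starRingEnd ℂ)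
  have hQ : 0 < Q.natDegree := by simpa [Q] using hR
  obtain ⟨t, ht⟩ := IsAlgClosed.exists_root (Q - C 1)
    (natDegree_pos_iff_degree_pos.mp (by rwa [natDegree_sub_C])).ne'
  obtain ⟨s, hs⟩ := IsAlgClosed.exists_root (R - C v)
    (natDegree_pos_iff_degree_pos.mp (by rwa [natDegree_sub_C])).ne'
  rw [IsRoot.def, eval_sub, eval_C, sub_eq_zero] at hs ht
  have hev (f : Fin 2 → ℂ) (p : MvPolynomial (Fin 2) ℂ) (S : ℂ[X]) :
      MvPolynomial.eval f (aeval p S) = S.eval (MvPolynomial.eval f p) := by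
    have := aeval_algHom_apply (MvPolynomial.aeval f : MvPolynomial (Fin 2) ℂ →ₐ[ℂ] ℂ) p S
    simpa [MvPolynomial.aeval_eq_eval] using this.symm
  refine ⟨![(s + t) / 2, -Complex.I * (s - t) / 2], ?_⟩
  rw [map_mul, hev, hev]
  simp only [map_add, map_sub, map_mul, MvPolynomial.eval_X, MvPolynomial.eval_C,
    Matrix.cons_val_zero, Matrix.cons_val_one]
  rw [show (s + t) / 2 + Complex.I * (-Complex.I * (s - t) / 2) = s by
      linear_combination (-(s - t) / 2) * Complex.I_mul_I,
    show (s + t) / 2 - Complex.I * (-Complex.I * (s - t) / 2) = t by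
      linear_combination ((s - t) / 2) * Complex.I_mul_I, hs, ht, mul_one]

theorem MvPolynomial.totalDegree_pos_of_eval_ne {σ R : Type*} [CommSemiring R]
    {p : MvPolynomial σ R} {f g : σ → R} (h : eval f p ≠ eval g p) : 0 < p.totalDegree := by
  by_contra! h0
  rw [totalDegree_eq_zero_iff_eq_C.mp (Nat.le_zero.mp h0)] at h
  simp at h

theorem polynomial_lemniscate_reducible_iff (P : Polynomial ℂ) (hP : 0 < P.natDegree) :
    P.LP.IsReducibleOverC ↔ ∃ (P₁ : Polynomial ℂ) (d : ℕ), 1 < d ∧ P = P₁ ^ d := by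
  constructor
  · rintro ⟨G, H, hG, hH, hGH⟩
    have hunit {A : MvPolynomial (Fin 2) ℂ} (hA : 0 < A.totalDegree) :
        ¬ IsUnit A.toConjCoords := fun h ↦
      hA.ne' (MvPolynomial.isUnit_iff_totalDegree_of_isReduced.mp
        (MvPolynomial.isUnit_of_isUnit_toConjCoords h)).2
    refine Polynomial.exists_eq_pow_of_mul_sub_one_eq_mul (Q := P.map (starRingEnd ℂ))
      (Polynomial.ne_zero_of_natDegree_gt hP) (by simpa using hP) (hunit hG) (hunit hH) ?_
    rw [← Polynomial.toConjCoords_LP, hGH, map_mul]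
  · rintro ⟨R, d, hd, rfl⟩
    have hR : 0 < R.natDegree := by
      rw [Polynomial.natDegree_pow] at hP
      exact Nat.pos_of_mul_pos_left hP
    have hval := Polynomial.exists_eval_mul_conj_eq hR
    rw [MvPolynomial.IsReducibleOverC, Polynomial.LP, Polynomial.map_pow, map_pow, map_pow,
      ← mul_pow]
    set u : MvPolynomial (Fin 2) ℂ :=
      Polynomial.aeval (MvPolynomial.X 0 + MvPolynomial.C Complex.I * MvPolynomial.X 1) R *
        Polynomial.aeval (MvPolynomial.X 0 - MvPolynomial.C Complex.I * MvPolynomial.X 1)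
          (R.map (starRingEnd ℂ))
    obtain ⟨f, hf⟩ := hval 0
    obtain ⟨g, hg⟩ := hval 2
    refine ⟨u - 1, ∑ i ∈ Finset.range d, u ^ i,
      MvPolynomial.totalDegree_pos_of_eval_ne (f := f) (g := g) ?_,
      MvPolynomial.totalDegree_pos_of_eval_ne (f := f) (g := g) ?_, (mul_geom_sum u d).symm⟩
    · norm_num [hf, hg]
    · have h0 : ∑ i ∈ Finset.range d, (0 : ℂ) ^ i = 1 := by
        simp [zero_geom_sum, (by lia : d ≠ 0)]
      have h2 : ∑ i ∈ Finset.range d, (2 : ℂ) ^ i = 2 ^ d - 1 := by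
        linear_combination mul_geom_sum (2 : ℂ) d
      simp only [map_sum, map_pow, hf, hg, h0, h2]
      intro h
      have hpow : (2 : ℂ) ^ d = 2 ^ 1 := by linear_combination -h
      have hnat : 2 ^ d = 2 ^ 1 := by exact_mod_cast hpow
      have := Nat.pow_right_injective le_rfl hnat
      lia
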